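/- The quantum EM distance is super-additive with respect to tensor-product partitions: for any two n-qubit states ρ, σ and any 1 ≤ k ≤ n−1, D_{EM}(ρ, σ) ≥ D_{EM}(ρ_{1…k}, σ_{1…k}) + D_{EM}(ρ_{k+1…n}, σ_{k+1…n}), where subscripts denote marginal states on the indicated qubits. Moreover, equality holds whenever ρ = ρ_{1…k} ⊗ ρ_{k+1…n} and σ = σ_{1…k} ⊗ σ_{k+1…n}. -/

import Mathlib

open scoped BigOperators ComplexOrder

/-- Matrices acting on `n` qubits. -/
abbrev QMat (n : ℕ) := Matrix (Fin n → Fin 2) (Fin n → Fin 2) ℂ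

/-- The trace norm (sum of the absolute values of the eigenvalues) of a Hermitian matrix. -/
noncomputable def traceNorm {n : ℕ} (X : QMat n) : ℝ :=
  if h : X.IsHermitian then ∑ i, |h.eigenvalues i| else 0

/-- The partial trace of `X` over qubit `i` vanishes. -/
def ptraceZero {n : ℕ} (i : Fin n) (X : QMat n) : Prop :=
  ∀ a b : Fin n → Fin 2,
    ∑ v : Fin 2, X (Function.update a i v) (Function.update b i v) = 0

/-- The quantum Wasserstein-1 (earth mover's) norm, primal formulation:
`‖X‖_EM = (1/2) min { Σᵢ ‖Xᵢ‖₁ : Xᵢ Hermitian, Trᵢ Xᵢ = 0, Σᵢ Xᵢ = X }`. -/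
noncomputable def emNorm {n : ℕ} (X : QMat n) : ℝ :=
  (1 / 2) * sInf { r | ∃ Xs : Fin n → QMat n,
    (∀ i, (Xs i).IsHermitian) ∧ (∀ i, ptraceZero i (Xs i)) ∧
    (∑ i, Xs i) = X ∧ r = ∑ i, traceNorm (Xs i) }

/-- The quantum Wasserstein-1 (earth mover's) distance. -/
noncomputable def emDist {n : ℕ} (ρ σ : QMat n) : ℝ := emNorm (ρ - σ)

/-- A density matrix: positive semidefinite with unit trace. -/
def IsState {n : ℕ} (ρ : QMat n) : Prop := ρ.PosSemidef ∧ ρ.trace = 1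

/-- Assemble a basis label of `n` qubits from labels of the first `k` and last `n−k` qubits. -/
def combine {n : ℕ} (k : ℕ) (hk : k ≤ n) (a : Fin k → Fin 2) (c : Fin (n - k) → Fin 2) :
    Fin n → Fin 2 :=
  fun j => if h : (j : ℕ) < k then a ⟨j, h⟩
    else c ⟨(j : ℕ) - k, by have := j.isLt; omega⟩

/-- The first `k` bits of a basis label. -/
def firstBits {n : ℕ} (k : ℕ) (hk : k ≤ n) (u : Fin n → Fin 2) : Fin k → Fin 2 :=
  fun j => u ⟨j, lt_of_lt_of_le j.isLt hk⟩

/-- The last `n − k` bits of a basis label. -/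
def lastBits {n : ℕ} (k : ℕ) (hk : k ≤ n) (u : Fin n → Fin 2) : Fin (n - k) → Fin 2 :=
  fun j => u ⟨k + j, by have := j.isLt; omega⟩

/-- The marginal of an `n`-qubit operator on the first `k` qubits
(partial trace over the last `n − k` qubits). -/
noncomputable def margFirst {n : ℕ} (k : ℕ) (hk : k ≤ n) (X : QMat n) : QMat k :=
  fun a b => ∑ c : Fin (n - k) → Fin 2, X (combine k hk a c) (combine k hk b c)

/-- The marginal of an `n`-qubit operator on the last `n − k` qubits
(partial trace over the first `k` qubits). -/
noncomputable def margLast {n : ℕ} (k : ℕ) (hk : k ≤ n) (X : QMat n) : QMat (n - k) :=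
  fun a b => ∑ c : Fin k → Fin 2, X (combine k hk c a) (combine k hk c b)

/-- The tensor product of an operator on the first `k` qubits with one on the last `n−k`. -/
noncomputable def tensorJoin {n : ℕ} (k : ℕ) (hk : k ≤ n)
    (A : QMat k) (B : QMat (n - k)) : QMat n :=
  fun u v => A (firstBits k hk u) (firstBits k hk v) * B (lastBits k hk u) (lastBits k hk v)

open Matrix in
lemma tn_decomp {n : ℕ} (X : QMat n) (h : X.IsHermitian) :
    ∃ P Q : QMat n, P.PosSemidef ∧ Q.PosSemidef ∧ X = P - Q ∧
      P.trace.re + Q.trace.re = traceNorm X := by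
  set U : QMat n := (h.eigenvectorUnitary : QMat n) with hU
  have hUU : star U * U = 1 := Unitary.coe_star_mul_self _
  have tr : ∀ d : (Fin n → Fin 2) → ℝ,
      (U * diagonal (fun i => (d i : ℂ)) * Uᴴ).trace.re = ∑ i, d i := by
    intro d
    rw [Matrix.trace_mul_comm, ← Matrix.mul_assoc, ← star_eq_conjTranspose, hUU, Matrix.one_mul,
      Matrix.trace_diagonal]
    simp
  have ps : ∀ d : (Fin n → Fin 2) → ℝ, (∀ i, 0 ≤ d i) →
      (U * diagonal (fun i => (d i : ℂ)) * Uᴴ).PosSemidef := by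
    intro d hd
    apply PosSemidef.mul_mul_conjTranspose_same
    rw [posSemidef_diagonal_iff]
    intro i
    exact_mod_cast hd i
  refine ⟨_, _, ps (fun i => max (h.eigenvalues i) 0) (fun i => le_max_right _ _),
    ps (fun i => max (-h.eigenvalues i) 0) (fun i => le_max_right _ _), ?_, ?_⟩
  · rw [← Matrix.sub_mul, ← Matrix.mul_sub, Matrix.diagonal_sub]
    conv_lhs => rw [h.spectral_theorem, Unitary.conjStarAlgAut_apply]
    congr 3
    funext i
    simp only [Function.comp]
    rw [← Complex.ofReal_sub]
    change ((h.eigenvalues i : ℝ) : ℂ) = _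
    congr 1
    rcases le_total 0 (h.eigenvalues i) with h0 | h0
    · rw [max_eq_left h0, max_eq_right (by linarith)]; ring
    · rw [max_eq_right h0, max_eq_left (by linarith)]; ring
  · rw [tr, tr, traceNorm, dif_pos h, ← Finset.sum_add_distrib]
    refine Finset.sum_congr rfl fun i _ => ?_
    rcases le_total 0 (h.eigenvalues i) with h0 | h0
    · rw [max_eq_left h0, max_eq_right (by linarith), abs_of_nonneg h0]; ring
    · rw [max_eq_right h0, max_eq_left (by linarith), abs_of_nonpos h0]; ring

open Matrix in
lemma tn_le {n : ℕ} (P Q : QMat n) (hP : P.PosSemidef) (hQ : Q.PosSemidef) :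
    traceNorm (P - Q) ≤ P.trace.re + Q.trace.re := by
  have h : (P - Q).IsHermitian := hP.isHermitian.sub hQ.isHermitian
  rw [traceNorm, dif_pos h]
  set U : QMat n := (h.eigenvectorUnitary : QMat n) with hU
  have hUU : U * star U = 1 := Unitary.coe_mul_star_self _
  have tr : ∀ A : QMat n, A.trace.re = ∑ i, ((Uᴴ * A * U) i i).re := by
    intro A
    have : A.trace = (Uᴴ * A * U).trace := by
      rw [Matrix.mul_assoc, Matrix.trace_mul_comm, Matrix.mul_assoc, ← star_eq_conjTranspose,
        hUU, Matrix.mul_one]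
    rw [this, Matrix.trace]
    simp
  rw [tr P, tr Q, ← Finset.sum_add_distrib]
  refine Finset.sum_le_sum fun i _ => ?_
  have key := h.conjStarAlgAut_star_eigenvectorUnitary
  rw [Unitary.conjStarAlgAut_star_apply] at key
  have k2 := congrFun (congrFun key i) i
  rw [Matrix.diagonal_apply_eq] at k2
  have k3 : h.eigenvalues i = ((Uᴴ * P * U) i i).re - ((Uᴴ * Q * U) i i).re := by
    have := congrArg Complex.re k2
    rw [Matrix.mul_sub, Matrix.sub_mul] at this
    simp only [Matrix.sub_apply, Complex.sub_re] at this
    exact this.symm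
  have p1 := (Complex.le_def.1 ((hP.conjTranspose_mul_mul_same U).diag_nonneg (i := i))).1
  have q1 := (Complex.le_def.1 ((hQ.conjTranspose_mul_mul_same U).diag_nonneg (i := i))).1
  simp only [Complex.zero_re] at p1 q1
  rw [k3, abs_le]
  constructor <;> linarith

lemma tn_nonneg {n : ℕ} (X : QMat n) : 0 ≤ traceNorm X := by
  unfold traceNorm
  split_ifs
  · exact Finset.sum_nonneg fun i _ => abs_nonneg _
  · exact le_rfl

def ptz {n : ℕ} (i : Fin n) : Submodule ℂ (QMat n) where
  carrier := {X | ptraceZero i X}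
  add_mem' := by
    intro a b ha hb x y
    simp only [Matrix.add_apply, Finset.sum_add_distrib]
    rw [ha x y, hb x y, add_zero]
  zero_mem' := by intro x y; simp
  smul_mem' := by
    intro c a ha x y
    simp only [Matrix.smul_apply, ← Finset.smul_sum]
    rw [ha x y, smul_zero]

lemma ptz_herm {n : ℕ} (i : Fin n) (X : QMat n) (h : ptraceZero i X) :
    ptraceZero i X.conjTranspose := by
  intro a b
  have := congrArg star (h b a)
  simpa [Matrix.conjTranspose_apply] using this

/-- complex span -/
def VV (n : ℕ) : Submodule ℂ (QMat n) := ⨆ i : Fin n, ptz i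

lemma VV_mem {n : ℕ} (X : QMat n) (h : X ∈ VV n) :
    ∃ Xs : Fin n → QMat n, (∀ i, ptraceZero i (Xs i)) ∧ ∑ i, Xs i = X := by
  unfold VV at h
  rw [Submodule.mem_iSup_iff_exists_finsupp] at h
  obtain ⟨f, hf, hs⟩ := h
  refine ⟨f, hf, ?_⟩
  rw [← hs, Finsupp.sum_fintype]
  simp

lemma single_off {n : ℕ} (a b : Fin n → Fin 2) (h : a ≠ b) :
    (Matrix.single a b (1 : ℂ)) ∈ VV n := by
  obtain ⟨i, hi⟩ := Function.ne_iff.1 h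
  refine Submodule.mem_iSup_of_mem i ?_
  intro x y
  refine Finset.sum_eq_zero fun v _ => ?_
  rw [Matrix.single_apply, if_neg]
  rintro ⟨rfl, rfl⟩
  simp at hi

lemma single_diag_step {n : ℕ} (a : Fin n → Fin 2) (i : Fin n) (w : Fin 2) :
    (Matrix.single (Function.update a i w) (Function.update a i w) (1 : ℂ)
      - Matrix.single a a 1) ∈ VV n := by
  refine Submodule.mem_iSup_of_mem i ?_
  intro x y
  have key : ∀ w : Fin 2, ∑ v : Fin 2, Matrix.single (Function.update a i w) (Function.update a i w) (1:ℂ)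
      (Function.update x i v) (Function.update y i v) =
      if (∀ j, j ≠ i → a j = x j) ∧ (∀ j, j ≠ i → a j = y j) then 1 else 0 := by
    intro w
    rw [Finset.sum_eq_single w]
    · rw [Matrix.single_apply]
      congr 1
      simp only [Function.update_eq_iff, Function.update_self, true_and, eq_iff_iff]
      constructor
      · rintro ⟨h1, h2⟩
        refine ⟨fun j hj => ?_, fun j hj => ?_⟩
        · simpa [hj] using h1 j hj
        · simpa [hj] using h2 j hj
      · rintro ⟨h1, h2⟩
        refine ⟨fun j hj => ?_, fun j hj => ?_⟩
        · simpa [hj] using h1 j hj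
        · simpa [hj] using h2 j hj
    · intro v _ hv
      rw [Matrix.single_apply, if_neg]
      rintro ⟨h1, -⟩
      have := congrFun h1 i
      simp at this
      exact hv this.symm
    · simp
  have k2 := key (a i)
  rw [Function.update_eq_self] at k2
  simp only [Matrix.sub_apply, Finset.sum_sub_distrib]
  rw [key w, k2, sub_self]

lemma single_diag {n : ℕ} (a : Fin n → Fin 2) :
    (Matrix.single a a (1 : ℂ) - Matrix.single 0 0 1) ∈ VV n := by
  have : ∀ s : Finset (Fin n), (Matrix.single (fun j => if j ∈ s then a j else 0)
      (fun j => if j ∈ s then a j else 0) (1 : ℂ) - Matrix.single 0 0 1) ∈ VV n := by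
    intro s
    induction s using Finset.induction_on with
    | empty =>
      simp only [Finset.notMem_empty, if_false]
      convert Submodule.zero_mem (VV n)
      exact sub_self _
    | insert i s hi ih =>
      have h1 := single_diag_step (fun j => if j ∈ s then a j else 0) i (a i)
      have h2 : Function.update (fun j => if j ∈ s then a j else 0) i (a i) =
          fun j => if j ∈ insert i s then a j else 0 := by
        funext j
        by_cases hj : j = i
        · subst hj; simp
        · simp [hj]
      rw [h2] at h1
      simpa using (VV n).add_mem h1 ih
  simpa using this Finset.univ

lemma traceless_mem {n : ℕ} (X : QMat n) (h : X.trace = 0) : X ∈ VV n := by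
  have e : X = ∑ a, ∑ b, X a b • (Matrix.single a b (1 : ℂ) -
      if a = b then Matrix.single 0 0 1 else 0) := by
    simp only [smul_sub, Finset.sum_sub_distrib]
    have h1 : ∑ a, ∑ b, X a b • (Matrix.single a b (1 : ℂ)) = X := by
      conv_rhs => rw [Matrix.matrix_eq_sum_single X]
      simp [Matrix.smul_single]
    have h2 : ∑ a, ∑ b, X a b • (if a = b then (Matrix.single 0 0 1 : QMat n) else 0) = 0 := by
      simp only [smul_ite, smul_zero, Finset.sum_ite_eq, Finset.mem_univ, if_true]
      rw [← Finset.sum_smul]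
      have : ∑ a, X a a = 0 := h
      rw [this, zero_smul]
    rw [h1, h2, sub_zero]
  rw [e]
  refine Submodule.sum_mem _ fun a _ => Submodule.sum_mem _ fun b _ => Submodule.smul_mem _ _ ?_
  by_cases hab : a = b
  · subst hab; rw [if_pos rfl]; exact single_diag a
  · rw [if_neg hab, sub_zero]; exact single_off a b hab

lemma feasible {n : ℕ} (X : QMat n) (hX : X.IsHermitian) (h : X.trace = 0) :
    ∃ Xs : Fin n → QMat n,
    (∀ i, (Xs i).IsHermitian) ∧ (∀ i, ptraceZero i (Xs i)) ∧ (∑ i, Xs i) = X := by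
  obtain ⟨Xs, h1, h2⟩ := VV_mem X (traceless_mem X h)
  refine ⟨fun i => (1/2 : ℂ) • (Xs i + (Xs i).conjTranspose), fun i => ?_, fun i => ?_, ?_⟩
  · rw [Matrix.IsHermitian, Matrix.conjTranspose_smul]
    simp [add_comm]
  · exact (ptz i).smul_mem _ ((ptz i).add_mem (h1 i) (ptz_herm i _ (h1 i)))
  · rw [← Finset.smul_sum, Finset.sum_add_distrib, ← Matrix.conjTranspose_sum, h2, hX.eq,
      ← two_smul ℂ, smul_smul]
    norm_num

def iL {n : ℕ} (k : ℕ) (hk : k ≤ n) (i : Fin k) : Fin n := ⟨i, lt_of_lt_of_le i.isLt hk⟩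

def iR {n : ℕ} (k : ℕ) (hk : k ≤ n) (j : Fin (n - k)) : Fin n :=
  ⟨k + j, by have := j.isLt; omega⟩

lemma sum_split {M : Type*} [AddCommMonoid M] {n : ℕ} (k : ℕ) (hk : k ≤ n) (f : Fin n → M) :
    ∑ i, f i = ∑ i, f (iL k hk i) + ∑ j, f (iR k hk j) := by
  rw [← Fintype.sum_equiv (finSumFinEquiv.trans (finCongr (by omega : k + (n - k) = n)))
    (fun s => f ((finSumFinEquiv.trans (finCongr (by omega : k + (n - k) = n))) s)) f
    (fun _ => rfl), Fintype.sum_sum_type]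
  rfl

lemma first_combine {n : ℕ} (k : ℕ) (hk : k ≤ n) (a : Fin k → Fin 2) (c : Fin (n - k) → Fin 2) :
    firstBits k hk (combine k hk a c) = a := by
  funext j; simp [firstBits, combine]

lemma last_combine {n : ℕ} (k : ℕ) (hk : k ≤ n) (a : Fin k → Fin 2) (c : Fin (n - k) → Fin 2) :
    lastBits k hk (combine k hk a c) = c := by
  funext j; simp [lastBits, combine]

lemma combine_bits {n : ℕ} (k : ℕ) (hk : k ≤ n) (u : Fin n → Fin 2) :
    combine k hk (firstBits k hk u) (lastBits k hk u) = u := by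
  funext j
  by_cases h : (j : ℕ) < k
  · simp [combine, firstBits, h]
  · simp only [combine, h, dif_neg, not_false_eq_true, lastBits]
    congr 1
    apply Fin.ext
    simp only
    omega

def cEquiv {n : ℕ} (k : ℕ) (hk : k ≤ n) :
    (Fin k → Fin 2) × (Fin (n - k) → Fin 2) ≃ (Fin n → Fin 2) where
  toFun p := combine k hk p.1 p.2
  invFun u := (firstBits k hk u, lastBits k hk u)
  left_inv p := by simp only [first_combine, last_combine]
  right_inv u := combine_bits k hk u

lemma combine_update_L {n : ℕ} (k : ℕ) (hk : k ≤ n) (a : Fin k → Fin 2)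
    (c : Fin (n - k) → Fin 2) (i : Fin k) (v : Fin 2) :
    combine k hk (Function.update a i v) c = Function.update (combine k hk a c) (iL k hk i) v := by
  funext j
  by_cases hj : j = iL k hk i
  · subst hj; simp [combine, iL]
  · rw [Function.update_of_ne hj]
    simp only [combine]
    split_ifs with h
    · rw [Function.update_of_ne]
      intro h'; apply hj; rw [← h']; rfl
    · rfl

lemma combine_update_R {n : ℕ} (k : ℕ) (hk : k ≤ n) (a : Fin k → Fin 2)
    (c : Fin (n - k) → Fin 2) (i : Fin (n - k)) (v : Fin 2) :
    combine k hk a (Function.update c i v) = Function.update (combine k hk a c) (iR k hk i) v := by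
  funext j
  by_cases hj : j = iR k hk i
  · subst hj; simp [combine, iR]
  · rw [Function.update_of_ne hj]
    simp only [combine]
    split_ifs with h
    · rfl
    · rw [Function.update_of_ne]
      intro h'; apply hj; rw [← h']; apply Fin.ext; simp only [iR]; omega

lemma first_update_L {n : ℕ} (k : ℕ) (hk : k ≤ n) (u : Fin n → Fin 2) (i : Fin k) (v : Fin 2) :
    firstBits k hk (Function.update u (iL k hk i) v) = Function.update (firstBits k hk u) i v := by
  conv_lhs => rw [← combine_bits k hk u, ← combine_update_L, first_combine]

lemma last_update_L {n : ℕ} (k : ℕ) (hk : k ≤ n) (u : Fin n → Fin 2) (i : Fin k) (v : Fin 2) :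
    lastBits k hk (Function.update u (iL k hk i) v) = lastBits k hk u := by
  conv_lhs => rw [← combine_bits k hk u, ← combine_update_L, last_combine]

lemma first_update_R {n : ℕ} (k : ℕ) (hk : k ≤ n) (u : Fin n → Fin 2) (i : Fin (n - k))
    (v : Fin 2) :
    firstBits k hk (Function.update u (iR k hk i) v) = firstBits k hk u := by
  conv_lhs => rw [← combine_bits k hk u, ← combine_update_R, first_combine]

lemma last_update_R {n : ℕ} (k : ℕ) (hk : k ≤ n) (u : Fin n → Fin 2) (i : Fin (n - k))
    (v : Fin 2) :
    lastBits k hk (Function.update u (iR k hk i) v) = Function.update (lastBits k hk u) i v := by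
  conv_lhs => rw [← combine_bits k hk u, ← combine_update_R, last_combine]

lemma sum_zero_of_update {m : ℕ} (j : Fin m) (g : (Fin m → Fin 2) → ℂ)
    (h : ∀ c, ∑ v, g (Function.update c j v) = 0) : ∑ c, g c = 0 := by
  have hinv : Function.Involutive (fun c : Fin m → Fin 2 => Function.update c j (1 - c j)) := by
    intro c
    funext l
    by_cases hl : l = j
    · subst hl; simp
    · simp [hl]
  have h1 : ∑ c, g (Function.update c j (1 - c j)) = ∑ c, g c :=
    Equiv.sum_comp (hinv.toPerm _) g
  have h2 : ∑ c, (g c + g (Function.update c j (1 - c j))) = 0 := by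
    refine Finset.sum_eq_zero fun c _ => ?_
    have h3 := h c
    rw [Fin.sum_univ_two] at h3
    have h4 : c j = 0 ∨ c j = 1 := by
      generalize c j = x
      revert x; decide
    rcases h4 with h4 | h4
    · have e : Function.update c j 0 = c := by rw [← h4, Function.update_eq_self]
      rw [e] at h3
      rw [h4]; exact h3
    · have e : Function.update c j 1 = c := by rw [← h4, Function.update_eq_self]
      rw [e] at h3
      rw [h4, add_comm]; exact h3
  rw [Finset.sum_add_distrib, h1] at h2
  have h5 : 2 * ∑ c, g c = 0 := by rw [two_mul]; exact h2
  simpa using h5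

section marg
variable {n : ℕ} (k : ℕ) (hk : k ≤ n)

lemma mF_eq (X : QMat n) : margFirst k hk X =
    ∑ c, X.submatrix (fun a => combine k hk a c) (fun a => combine k hk a c) := by
  ext a b; simp [margFirst, Matrix.sum_apply]

lemma mL_eq (X : QMat n) : margLast k hk X =
    ∑ c, X.submatrix (fun a => combine k hk c a) (fun a => combine k hk c a) := by
  ext a b; simp [margLast, Matrix.sum_apply]

lemma mF_psd (X : QMat n) (h : X.PosSemidef) : (margFirst k hk X).PosSemidef := by
  rw [mF_eq]; exact Matrix.posSemidef_sum _ fun c _ => h.submatrix _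

lemma mL_psd (X : QMat n) (h : X.PosSemidef) : (margLast k hk X).PosSemidef := by
  rw [mL_eq]; exact Matrix.posSemidef_sum _ fun c _ => h.submatrix _

lemma mF_sub (X Y : QMat n) : margFirst k hk (X - Y) = margFirst k hk X - margFirst k hk Y := by
  ext a b; simp [margFirst]

lemma mL_sub (X Y : QMat n) : margLast k hk (X - Y) = margLast k hk X - margLast k hk Y := by
  ext a b; simp [margLast]

lemma mF_sum {ι : Type*} (s : Finset ι) (X : ι → QMat n) :
    margFirst k hk (∑ i ∈ s, X i) = ∑ i ∈ s, margFirst k hk (X i) := by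
  ext a b; simp only [margFirst, Matrix.sum_apply]; exact Finset.sum_comm

lemma mL_sum {ι : Type*} (s : Finset ι) (X : ι → QMat n) :
    margLast k hk (∑ i ∈ s, X i) = ∑ i ∈ s, margLast k hk (X i) := by
  ext a b; simp only [margLast, Matrix.sum_apply]; exact Finset.sum_comm

lemma mF_trace (X : QMat n) : (margFirst k hk X).trace = X.trace := by
  simp only [Matrix.trace, Matrix.diag, margFirst]
  rw [← Fintype.sum_prod_type']
  exact Equiv.sum_comp (cEquiv k hk) (fun u => X u u)

lemma mL_trace (X : QMat n) : (margLast k hk X).trace = X.trace := by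
  simp only [Matrix.trace, Matrix.diag, margLast]
  rw [Finset.sum_comm, ← Fintype.sum_prod_type']
  exact Equiv.sum_comp (cEquiv k hk) (fun u => X u u)

lemma mF_herm (X : QMat n) (h : X.IsHermitian) : (margFirst k hk X).IsHermitian := by
  ext a b
  simp only [Matrix.conjTranspose_apply, margFirst, star_sum]
  exact Finset.sum_congr rfl fun c _ => h.apply _ _

lemma mL_herm (X : QMat n) (h : X.IsHermitian) : (margLast k hk X).IsHermitian := by
  ext a b
  simp only [Matrix.conjTranspose_apply, margLast, star_sum]
  exact Finset.sum_congr rfl fun c _ => h.apply _ _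

lemma mF_tn (X : QMat n) (h : X.IsHermitian) : traceNorm (margFirst k hk X) ≤ traceNorm X := by
  obtain ⟨P, Q, hP, hQ, e, ht⟩ := tn_decomp X h
  rw [← ht, e, mF_sub, ← mF_trace k hk P, ← mF_trace k hk Q]
  exact tn_le _ _ (mF_psd k hk P hP) (mF_psd k hk Q hQ)

lemma mL_tn (X : QMat n) (h : X.IsHermitian) : traceNorm (margLast k hk X) ≤ traceNorm X := by
  obtain ⟨P, Q, hP, hQ, e, ht⟩ := tn_decomp X h
  rw [← ht, e, mL_sub, ← mL_trace k hk P, ← mL_trace k hk Q]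
  exact tn_le _ _ (mL_psd k hk P hP) (mL_psd k hk Q hQ)

lemma mF_ptz (X : QMat n) (i : Fin k) (h : ptraceZero (iL k hk i) X) :
    ptraceZero i (margFirst k hk X) := by
  intro a b
  simp only [margFirst]
  rw [Finset.sum_comm]
  refine Finset.sum_eq_zero fun c _ => ?_
  simp only [combine_update_L]
  exact h _ _

lemma mL_ptz (X : QMat n) (i : Fin (n - k)) (h : ptraceZero (iR k hk i) X) :
    ptraceZero i (margLast k hk X) := by
  intro a b
  simp only [margLast]
  rw [Finset.sum_comm]
  refine Finset.sum_eq_zero fun c _ => ?_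
  simp only [combine_update_R]
  exact h _ _

lemma mF_zero (X : QMat n) (j : Fin (n - k)) (h : ptraceZero (iR k hk j) X) :
    margFirst k hk X = 0 := by
  ext a b
  simp only [margFirst, Matrix.zero_apply]
  refine sum_zero_of_update j (fun c => X (combine k hk a c) (combine k hk b c)) fun c => ?_
  simp only [combine_update_R]
  exact h _ _

lemma mL_zero (X : QMat n) (j : Fin k) (h : ptraceZero (iL k hk j) X) :
    margLast k hk X = 0 := by
  ext a b
  simp only [margLast, Matrix.zero_apply]
  refine sum_zero_of_update j (fun c => X (combine k hk c a) (combine k hk c b)) fun c => ?_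
  simp only [combine_update_L]
  exact h _ _

lemma tj_eq (A : QMat k) (B : QMat (n - k)) : tensorJoin k hk A B =
    (Matrix.kronecker A B).submatrix (fun u => (firstBits k hk u, lastBits k hk u))
      (fun u => (firstBits k hk u, lastBits k hk u)) := by
  ext u v; rfl

lemma tj_psd (A : QMat k) (B : QMat (n - k)) (hA : A.PosSemidef) (hB : B.PosSemidef) :
    (tensorJoin k hk A B).PosSemidef := by
  rw [tj_eq]; exact (hA.kronecker hB).submatrix _

lemma tj_herm (A : QMat k) (B : QMat (n - k)) (hA : A.IsHermitian) (hB : B.IsHermitian) :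
    (tensorJoin k hk A B).IsHermitian := by
  ext u v
  simp only [Matrix.conjTranspose_apply, tensorJoin, star_mul']
  rw [hA.apply, hB.apply]

lemma tj_trace (A : QMat k) (B : QMat (n - k)) :
    (tensorJoin k hk A B).trace = A.trace * B.trace := by
  simp only [Matrix.trace, Matrix.diag, tensorJoin]
  rw [← Equiv.sum_comp (cEquiv k hk), Finset.sum_mul_sum, Fintype.sum_prod_type]
  simp [cEquiv, first_combine, last_combine]

lemma tj_sub_left (A A' : QMat k) (B : QMat (n - k)) :
    tensorJoin k hk (A - A') B = tensorJoin k hk A B - tensorJoin k hk A' B := by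
  ext u v; simp [tensorJoin, sub_mul]

lemma tj_sub_right (A : QMat k) (B B' : QMat (n - k)) :
    tensorJoin k hk A (B - B') = tensorJoin k hk A B - tensorJoin k hk A B' := by
  ext u v; simp [tensorJoin, mul_sub]

lemma tj_sum_left {ι : Type*} (s : Finset ι) (A : ι → QMat k) (B : QMat (n - k)) :
    tensorJoin k hk (∑ i ∈ s, A i) B = ∑ i ∈ s, tensorJoin k hk (A i) B := by
  ext u v; simp [tensorJoin, Matrix.sum_apply, Finset.sum_mul]

lemma tj_sum_right {ι : Type*} (s : Finset ι) (A : QMat k) (B : ι → QMat (n - k)) :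
    tensorJoin k hk A (∑ i ∈ s, B i) = ∑ i ∈ s, tensorJoin k hk A (B i) := by
  ext u v; simp [tensorJoin, Matrix.sum_apply, Finset.mul_sum]

lemma tj_tn_left (A : QMat k) (B : QMat (n - k)) (hA : A.IsHermitian) (hB : IsState B) :
    traceNorm (tensorJoin k hk A B) ≤ traceNorm A := by
  obtain ⟨P, Q, hP, hQ, e, ht⟩ := tn_decomp A hA
  rw [← ht, e, tj_sub_left]
  refine (tn_le _ _ (tj_psd k hk P B hP hB.1) (tj_psd k hk Q B hQ hB.1)).trans (le_of_eq ?_)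
  rw [tj_trace, tj_trace, hB.2, mul_one, mul_one]

lemma tj_tn_right (A : QMat k) (B : QMat (n - k)) (hA : IsState A) (hB : B.IsHermitian) :
    traceNorm (tensorJoin k hk A B) ≤ traceNorm B := by
  obtain ⟨P, Q, hP, hQ, e, ht⟩ := tn_decomp B hB
  rw [← ht, e, tj_sub_right]
  refine (tn_le _ _ (tj_psd k hk A P hA.1 hP) (tj_psd k hk A Q hA.1 hQ)).trans (le_of_eq ?_)
  rw [tj_trace, tj_trace, hA.2, one_mul, one_mul]

lemma tj_ptz_left (A : QMat k) (B : QMat (n - k)) (i : Fin k) (h : ptraceZero i A) :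
    ptraceZero (iL k hk i) (tensorJoin k hk A B) := by
  intro a b
  simp only [tensorJoin, first_update_L, last_update_L]
  rw [← Finset.sum_mul, h, zero_mul]

lemma tj_ptz_right (A : QMat k) (B : QMat (n - k)) (j : Fin (n - k)) (h : ptraceZero j B) :
    ptraceZero (iR k hk j) (tensorJoin k hk A B) := by
  intro a b
  simp only [tensorJoin, first_update_R, last_update_R]
  rw [← Finset.mul_sum, h, mul_zero]

end marg

/-- the feasible set of costs -/
def costs {n : ℕ} (X : QMat n) : Set ℝ := { r | ∃ Xs : Fin n → QMat n,
    (∀ i, (Xs i).IsHermitian) ∧ (∀ i, ptraceZero i (Xs i)) ∧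
    (∑ i, Xs i) = X ∧ r = ∑ i, traceNorm (Xs i) }

lemma costs_bdd {n : ℕ} (X : QMat n) : BddBelow (costs X) := by
  refine ⟨0, ?_⟩
  rintro r ⟨Xs, -, -, -, rfl⟩
  exact Finset.sum_nonneg fun i _ => tn_nonneg _

lemma costs_ne {n : ℕ} (X : QMat n) (hX : X.IsHermitian) (h : X.trace = 0) :
    (costs X).Nonempty := by
  obtain ⟨Xs, h1, h2, h3⟩ := feasible X hX h
  exact ⟨_, Xs, h1, h2, h3, rfl⟩

lemma super_ineq {n : ℕ} (k : ℕ) (hk : k ≤ n) (X : QMat n) (hX : X.IsHermitian)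
    (h : X.trace = 0) :
    sInf (costs (margFirst k hk X)) + sInf (costs (margLast k hk X)) ≤ sInf (costs X) := by
  refine le_csInf (costs_ne X hX h) ?_
  rintro r ⟨Xs, h1, h2, h3, rfl⟩
  rw [sum_split k hk]
  refine add_le_add ?_ ?_
  · refine (csInf_le (costs_bdd _) ⟨fun i => margFirst k hk (Xs (iL k hk i)),
      fun i => mF_herm _ _ _ (h1 _), fun i => mF_ptz _ _ _ _ (h2 _), ?_, rfl⟩).trans
      (Finset.sum_le_sum fun i _ => mF_tn _ _ _ (h1 _))
    rw [← h3, mF_sum, sum_split k hk (fun i => margFirst k hk (Xs i))]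
    rw [Finset.sum_eq_zero (s := Finset.univ)
      (f := fun j => margFirst k hk (Xs (iR k hk j))) fun j _ => mF_zero k hk _ j (h2 _), add_zero]
  · refine (csInf_le (costs_bdd _) ⟨fun i => margLast k hk (Xs (iR k hk i)),
      fun i => mL_herm _ _ _ (h1 _), fun i => mL_ptz _ _ _ _ (h2 _), ?_, rfl⟩).trans
      (Finset.sum_le_sum fun i _ => mL_tn _ _ _ (h1 _))
    rw [← h3, mL_sum, sum_split k hk (fun i => margLast k hk (Xs i))]
    rw [Finset.sum_eq_zero (s := Finset.univ)
      (f := fun j => margLast k hk (Xs (iL k hk j))) fun j _ => mL_zero k hk _ j (h2 _), zero_add]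

lemma sub_ineq {n : ℕ} (k : ℕ) (hk : k ≤ n) (ρ₁ σ₁ : QMat k) (ρ₂ σ₂ : QMat (n - k))
    (h1 : IsState ρ₁) (h2 : IsState σ₁) (h3 : IsState ρ₂) (h4 : IsState σ₂) :
    sInf (costs (tensorJoin k hk ρ₁ ρ₂ - tensorJoin k hk σ₁ σ₂)) ≤
      sInf (costs (ρ₁ - σ₁)) + sInf (costs (ρ₂ - σ₂)) := by
  have n1 : (costs (ρ₁ - σ₁)).Nonempty := costs_ne _ (h1.1.isHermitian.sub h2.1.isHermitian)
    (by rw [Matrix.trace_sub, h1.2, h2.2, sub_self])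
  have n2 : (costs (ρ₂ - σ₂)).Nonempty := costs_ne _ (h3.1.isHermitian.sub h4.1.isHermitian)
    (by rw [Matrix.trace_sub, h3.2, h4.2, sub_self])
  suffices H : ∀ r ∈ costs (ρ₁ - σ₁), ∀ s ∈ costs (ρ₂ - σ₂),
      sInf (costs (tensorJoin k hk ρ₁ ρ₂ - tensorJoin k hk σ₁ σ₂)) ≤ r + s by
    have : ∀ s ∈ costs (ρ₂ - σ₂),
        sInf (costs (tensorJoin k hk ρ₁ ρ₂ - tensorJoin k hk σ₁ σ₂)) - s ≤
          sInf (costs (ρ₁ - σ₁)) := fun s hs =>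
      le_csInf n1 fun r hr => by linarith [H r hr s hs]
    have := le_csInf n2 (a := sInf (costs (tensorJoin k hk ρ₁ ρ₂ - tensorJoin k hk σ₁ σ₂)) -
      sInf (costs (ρ₁ - σ₁))) fun s hs => by linarith [this s hs]
    linarith
  rintro r ⟨Xs, x1, x2, x3, rfl⟩ s ⟨Ys, y1, y2, y3, rfl⟩
  let Z : Fin n → QMat n := fun l => if h : (l : ℕ) < k then tensorJoin k hk (Xs ⟨l, h⟩) ρ₂
    else tensorJoin k hk σ₁ (Ys ⟨(l : ℕ) - k, by have := l.isLt; omega⟩)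
  have zL : ∀ i, Z (iL k hk i) = tensorJoin k hk (Xs i) ρ₂ := by
    intro i; simp [Z, iL]
  have zR : ∀ j, Z (iR k hk j) = tensorJoin k hk σ₁ (Ys j) := by
    intro j; simp [Z, iR]
  have cov : ∀ l : Fin n, (∃ i, l = iL k hk i) ∨ ∃ j, l = iR k hk j := by
    intro l
    by_cases h : (l : ℕ) < k
    · exact Or.inl ⟨⟨l, h⟩, rfl⟩
    · refine Or.inr ⟨⟨(l : ℕ) - k, by have := l.isLt; omega⟩, Fin.ext ?_⟩
      simp only [iR]; omega
  refine (csInf_le (costs_bdd _) ⟨Z, fun l => ?_, fun l => ?_, ?_, rfl⟩).trans ?_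
  · rcases cov l with ⟨i, rfl⟩ | ⟨j, rfl⟩
    · rw [zL]; exact tj_herm _ _ _ _ (x1 i) h3.1.isHermitian
    · rw [zR]; exact tj_herm _ _ _ _ h2.1.isHermitian (y1 j)
  · rcases cov l with ⟨i, rfl⟩ | ⟨j, rfl⟩
    · rw [zL]; exact tj_ptz_left _ _ _ _ _ (x2 i)
    · rw [zR]; exact tj_ptz_right _ _ _ _ _ (y2 j)
  · rw [sum_split k hk]
    simp only [zL, zR]
    rw [← tj_sum_left, ← tj_sum_right, x3, y3, tj_sub_left, tj_sub_right]
    abel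
  · rw [sum_split k hk]
    simp only [zL, zR]
    exact add_le_add (Finset.sum_le_sum fun i _ => tj_tn_left _ _ _ _ (x1 i) h3)
      (Finset.sum_le_sum fun j _ => tj_tn_right _ _ _ _ h2 (y1 j))

lemma emDist_costs {n : ℕ} (ρ σ : QMat n) : emDist ρ σ = (1 / 2) * sInf (costs (ρ - σ)) := rfl

/-- Super-additivity of the quantum EM distance with respect to tensor-product partitions,
with equality for product states. -/
theorem emDist_superadditive (n k : ℕ) (hk1 : 1 ≤ k) (hk2 : k ≤ n - 1) (hkn : k ≤ n)
    (ρ σ : QMat n) (hρ : IsState ρ) (hσ : IsState σ) :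
    (emDist (margFirst k hkn ρ) (margFirst k hkn σ) +
        emDist (margLast k hkn ρ) (margLast k hkn σ) ≤ emDist ρ σ) ∧
    ((ρ = tensorJoin k hkn (margFirst k hkn ρ) (margLast k hkn ρ)) →
      (σ = tensorJoin k hkn (margFirst k hkn σ) (margLast k hkn σ)) →
      emDist ρ σ =
        emDist (margFirst k hkn ρ) (margFirst k hkn σ) +
          emDist (margLast k hkn ρ) (margLast k hkn σ)) := by
  have h1 := super_ineq k hkn (ρ - σ) (hρ.1.isHermitian.sub hσ.1.isHermitian)
    (by rw [Matrix.trace_sub, hρ.2, hσ.2, sub_self])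
  rw [mF_sub, mL_sub] at h1
  simp only [emDist_costs]
  refine ⟨by linarith, fun e1 e2 => ?_⟩
  have h2 := sub_ineq k hkn (margFirst k hkn ρ) (margFirst k hkn σ) (margLast k hkn ρ)
    (margLast k hkn σ) ⟨mF_psd _ _ _ hρ.1, by rw [mF_trace, hρ.2]⟩
    ⟨mF_psd _ _ _ hσ.1, by rw [mF_trace, hσ.2]⟩ ⟨mL_psd _ _ _ hρ.1, by rw [mL_trace, hρ.2]⟩
    ⟨mL_psd _ _ _ hσ.1, by rw [mL_trace, hσ.2]⟩
  rw [← e1, ← e2] at h2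
  linarith
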